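/- The ideal I = ker(π̄) of 𝒫 is generated by the finitely many elements g_{i,j,r,s} := t'_{ir}t'_{js} − t'_{is}t'_{jr} − (t'_i t'_r + t'_j t'_s − t'_j t'_r − t'_i t'_s) + (t'_i t'_{jr} + t'_j t'_{is} + t'_r t'_{is} + t'_s t'_{jr} − t'_j t'_{ir} − t'_i t'_{js} − t'_r t'_{js} − t'_s t'_{ir}) + (1/2)(t'_j t'_r t'_{is} + t'_i t'_s t'_{jr} − t'_i t'_r t'_{js} − t'_j t'_s t'_{ir}), for all indices 1 ≤ i, j, r, s ≤ n, where in these expressions t'_{ab} for a > b means t'_{ba}, and t'_{aa} means (t'_a)² + 4t'_a. In particular, I is a finitely generated ideal of 𝒫. -/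

import Mathlib

set_option synthInstance.maxHeartbeats 1000000
set_option maxHeartbeats 1000000

noncomputable section

abbrev SL2 : Type := Matrix.SpecialLinearGroup (Fin 2) ℂ

/-- The free abelian group of rank `n`, written multiplicatively. -/
abbrev H (n : ℕ) : Type := Multiplicative (Fin n → ℤ)

/-- The algebra of complex-valued functions on the representation space `R(H)`. -/
abbrev FR (n : ℕ) : Type := (H n →* SL2) → ℂ

/-- The standard basis element `x_i` of `H`. -/
def xgen (n : ℕ) (i : Fin n) : H n := Multiplicative.ofAdd (Pi.single i 1)

/-- The Fricke character `tr x`. -/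
def trc {n : ℕ} (x : H n) : FR n :=
  fun ρ => Matrix.trace ((ρ x : Matrix (Fin 2) (Fin 2) ℂ))

/-- The ring of Fricke characters `𝔛_ℚ(H)`. -/
def Xring (n : ℕ) : Subalgebra ℚ (FR n) :=
  Algebra.adjoin ℚ {f : FR n | ∃ x : H n, f = trc x}

/-- The variables of the polynomial ring `𝒫`: one variable `t_i` for each `1 ≤ i ≤ n`
and one variable `t_{ij}` for each pair `1 ≤ i < j ≤ n`. -/
abbrev Vars (n : ℕ) : Type := Fin n ⊕ {p : Fin n × Fin n // p.1 < p.2}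

/-- The polynomial ring `𝒫 = ℚ[t_i, t_{ij}]`. -/
abbrev P (n : ℕ) : Type := MvPolynomial (Vars n) ℚ

/-- The ℚ-algebra homomorphism `π̄ : 𝒫 → F(R(H),ℂ)` with `π̄(t_i) = tr x_i` and
`π̄(t_{ij}) = tr (x_i x_j)`. -/
def piBar (n : ℕ) : P n →ₐ[ℚ] FR n :=
  MvPolynomial.aeval fun v =>
    match v with
    | Sum.inl i => trc (xgen n i)
    | Sum.inr p => trc (xgen n p.1.1 * xgen n p.1.2)

/-- The ideal `I = ker π̄` of `𝒫`. -/
def Iideal (n : ℕ) : Ideal (P n) := RingHom.ker (piBar n).toRingHom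

/-- `t'_i = t_i - 2`. -/
def tp (n : ℕ) (i : Fin n) : P n := MvPolynomial.X (Sum.inl i) - 2

/-- `t'_{ij} = t_{ij} - 2` for arbitrary indices `i`, `j`, where `t'_{ij}` for `i > j` is read as
`t'_{ji}`, and `t'_{ii}` is read as `(t'_i)² + 4 t'_i`. -/
def tpp (n : ℕ) (i j : Fin n) : P n :=
  if h : i < j then MvPolynomial.X (Sum.inr ⟨(i, j), h⟩) - 2
  else if h' : j < i then MvPolynomial.X (Sum.inr ⟨(j, i), h'⟩) - 2
  else tp n i ^ 2 + 4 * tp n i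

/-- The generator `g_{i,j,r,s}` of the ideal `I`. -/
def gGen (n : ℕ) (i j r s : Fin n) : P n :=
  tpp n i r * tpp n j s - tpp n i s * tpp n j r
    - (tp n i * tp n r + tp n j * tp n s - tp n j * tp n r - tp n i * tp n s)
    + (tp n i * tpp n j r + tp n j * tpp n i s + tp n r * tpp n i s + tp n s * tpp n j r
        - tp n j * tpp n i r - tp n i * tpp n j s - tp n r * tpp n j s - tp n s * tpp n i r)
    + MvPolynomial.C (1 / 2 : ℚ) *
        (tp n j * tp n r * tpp n i s + tp n i * tp n s * tpp n j r
          - tp n i * tp n r * tpp n j s - tp n j * tp n s * tpp n i r)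

section PairingProduct

variable {ι A : Type*} [CommRing A]

/-- The product `D i₁ i₂ * D i₃ i₄ * ⋯` along a list `[i₁, i₂, i₃, i₄, …]`, taken to be `0` on lists
of odd length. -/
def pairProd (D : ι → ι → A) : List ι → A
  | [] => 1
  | [_] => 0
  | i :: j :: l => D i j * pairProd D l

theorem pairProd_perm {D : ι → ι → A} (hsymm : ∀ i j, D i j = D j i)
    (hswap : ∀ i j k l, D i j * D k l = D i k * D j l) {l₁ l₂ : List ι} (h : l₁.Perm l₂) :
    pairProd D l₁ = pairProd D l₂ ∧ ∀ k, pairProd D (k :: l₁) = pairProd D (k :: l₂) := by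
  induction h with
  | nil => exact ⟨rfl, fun _ => rfl⟩
  | cons x _ ih => exact ⟨ih.2 x, fun k => by simp only [pairProd, ih.1]⟩
  | swap x y l =>
    refine ⟨by simp only [pairProd, hsymm x y], fun k => ?_⟩
    cases l with
    | nil => simp [pairProd]
    | cons z l => simp only [pairProd, ← mul_assoc, hswap k y x z]
  | trans _ _ ih₁ ih₂ => exact ⟨ih₁.1.trans ih₂.1, fun k => (ih₁.2 k).trans (ih₂.2 k)⟩

/-- A symmetric family `D i j` satisfying the rank one relations admits a linear map from a
polynomial ring which turns multiplication by `X i * X j` into multiplication by `D i j`. -/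
theorem exists_linear_of_pairing {R : Type*} [CommRing R] [Algebra R A] (D : ι → ι → A)
    (hsymm : ∀ i j, D i j = D j i) (hswap : ∀ i j k l, D i j * D k l = D i k * D j l) :
    ∃ Ψ : MvPolynomial ι R →ₗ[R] A, Ψ 1 = 1 ∧
      ∀ i j q, Ψ (MvPolynomial.X i * MvPolynomial.X j * q) = D i j * Ψ q := by
  let E : Multiset ι → A :=
    fun m => Quot.liftOn m (pairProd D) fun _ _ h => (pairProd_perm hsymm hswap h).1
  have hE : ∀ i j m, E (i ::ₘ j ::ₘ m) = D i j * E m := fun i j m =>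
    Quot.inductionOn m fun _ => rfl
  let Ψ := (MvPolynomial.basisMonomials ι R).constr R fun m => E (Finsupp.toMultiset m)
  have hΨ : ∀ m, Ψ (MvPolynomial.monomial m 1) = E (Finsupp.toMultiset m) := fun m => by
    have := (MvPolynomial.basisMonomials ι R).constr_basis R
      (fun m => E (Finsupp.toMultiset m)) m
    rwa [MvPolynomial.coe_basisMonomials] at this
  refine ⟨Ψ, ?_, fun i j q => ?_⟩
  · have := hΨ 0
    rw [map_zero] at this
    exact this
  · induction q using MvPolynomial.induction_on' with
    | add p q hp hq => rw [mul_add, map_add, map_add, hp, hq, mul_add]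
    | monomial m r =>
      have h₁ : (MvPolynomial.X i * MvPolynomial.X j * MvPolynomial.monomial m r :
          MvPolynomial ι R) = r • MvPolynomial.monomial
            (Finsupp.single i 1 + (Finsupp.single j 1 + m)) 1 := by
        rw [MvPolynomial.smul_monomial, MvPolynomial.X, MvPolynomial.X, mul_assoc,
          MvPolynomial.monomial_mul, MvPolynomial.monomial_mul]
        simp
      have h₂ : (MvPolynomial.monomial m r : MvPolynomial ι R) =
          r • MvPolynomial.monomial m 1 := by
        rw [MvPolynomial.smul_monomial]; simp
      rw [h₁, h₂, map_smul, map_smul, hΨ, hΨ, mul_smul_comm]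
      congr 1
      rw [map_add, map_add, Finsupp.toMultiset_single, Finsupp.toMultiset_single, one_smul,
        one_smul, Multiset.singleton_add, Multiset.singleton_add, hE]

end PairingProduct

section Torus

variable {ι : Type*}

open MvPolynomial

/-- Evaluation at the point of the torus `τ_i ^ 2 - δ_i ^ 2 = 4` given by `τ_i = a_i + a_i⁻¹` and
`δ_i = a_i - a_i⁻¹`; here the `τ_i` are the variables of the coefficient ring. -/
def torusEval (a : ι → ℂˣ) : MvPolynomial ι (MvPolynomial ι ℚ) →+* ℂ :=
  eval₂Hom (aeval fun i => (a i : ℂ) + ((a i)⁻¹ : ℂˣ) : MvPolynomial ι ℚ →ₐ[ℚ] ℂ).toRingHom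
    fun i => (a i : ℂ) - ((a i)⁻¹ : ℂˣ)

/-- The ideal of relations `δ_i ^ 2 = τ_i ^ 2 - 4`. -/
def torusIdeal (ι : Type*) : Ideal (MvPolynomial ι (MvPolynomial ι ℚ)) :=
  Ideal.span (Set.range fun i => X i ^ 2 - C (X i ^ 2 - 4))

theorem torusEval_eq_zero_of_mem (a : ι → ℂˣ) {q : MvPolynomial ι (MvPolynomial ι ℚ)}
    (hq : q ∈ torusIdeal ι) : torusEval a q = 0 := by
  have : torusIdeal ι ≤ RingHom.ker (torusEval a) := by
    refine Ideal.span_le.2 ?_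
    rintro _ ⟨i, rfl⟩
    have h : (a i : ℂ) * ((a i)⁻¹ : ℂˣ) = 1 := Units.mul_inv _
    simp only [SetLike.mem_coe, RingHom.mem_ker, torusEval, map_sub, map_pow, coe_eval₂Hom,
      eval₂_X, eval₂_C, AlgHom.toRingHom_eq_coe, RingHom.coe_coe, aeval_X, map_ofNat]
    linear_combination (-4) * h
  exact this hq

/-- Twice the coordinate `a_i`, as a polynomial in `τ_i` and `δ_i`. -/
def torusCoord (i : ι) : MvPolynomial ι (MvPolynomial ι ℚ) := C (X i) + X i

theorem isUnit_mk_torusCoord (i : ι) :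
    IsUnit (Ideal.Quotient.mk (torusIdeal ι) (torusCoord i)) := by
  refine isUnit_of_dvd_one
    ⟨Ideal.Quotient.mk (torusIdeal ι) (C (C (1 / 4)) * (C (X i) - X i)), Eq.symm ?_⟩
  rw [← map_mul, ← map_one (Ideal.Quotient.mk (torusIdeal ι)), Ideal.Quotient.eq]
  have h4 : (C (C (1 / 4 : ℚ)) * 4 : MvPolynomial ι (MvPolynomial ι ℚ)) = 1 := by
    rw [← map_ofNat (C : MvPolynomial ι ℚ →+* _) 4, ← map_ofNat (C : ℚ →+* _) 4, ← map_mul,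
      ← map_mul]
    norm_num
  have hm : (X i ^ 2 - C (X i ^ 2 - 4) : MvPolynomial ι (MvPolynomial ι ℚ)) ∈ torusIdeal ι :=
    Ideal.subset_span ⟨i, rfl⟩
  convert (torusIdeal ι).mul_mem_left (- C (C (1 / 4 : ℚ))) hm using 1
  rw [torusCoord, map_sub, map_pow, map_ofNat]
  linear_combination h4

/-- After clearing denominators, every function on the torus is a polynomial in the
coordinates. -/
theorem exists_mul_pow_sub_mem [Fintype ι] (q : MvPolynomial ι (MvPolynomial ι ℚ)) :
    ∃ (N : ℕ) (G : MvPolynomial ι ℚ),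
      q * (∏ i, torusCoord i) ^ N - aeval torusCoord G ∈ torusIdeal ι := by
  classical
  let T : (MvPolynomial ι (MvPolynomial ι ℚ)) → Prop := fun q =>
    ∃ (N : ℕ) (G : MvPolynomial ι ℚ),
      q * (∏ i, torusCoord i) ^ N - aeval torusCoord G ∈ torusIdeal ι
  have hadd : ∀ p q, T p → T q → T (p + q) := by
    rintro p q ⟨N, G, hp⟩ ⟨M, F, hq⟩
    refine ⟨N + M, G * (∏ i, X i) ^ M + F * (∏ i, X i) ^ N, ?_⟩
    have := add_mem ((torusIdeal ι).mul_mem_left ((∏ i, torusCoord i) ^ M) hp)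
      ((torusIdeal ι).mul_mem_left ((∏ i, torusCoord i) ^ N) hq)
    convert this using 1
    simp only [map_add, map_mul, map_pow, map_prod, aeval_X]
    ring
  have hmul : ∀ p q, T p → T q → T (p * q) := by
    rintro p q ⟨N, G, hp⟩ ⟨M, F, hq⟩
    refine ⟨N + M, G * F, ?_⟩
    have := add_mem ((torusIdeal ι).mul_mem_left (q * (∏ i, torusCoord i) ^ M) hp)
      ((torusIdeal ι).mul_mem_left (aeval torusCoord G) hq)
    convert this using 1
    simp only [map_mul]
    ring
  have hconst : ∀ r : ℚ, T (C (C r)) := fun r => ⟨0, C r, by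
    simp [MvPolynomial.algebraMap_eq, IsScalarTower.algebraMap_apply ℚ (MvPolynomial ι ℚ)]⟩
  have hgen : ∀ i, ∀ x : MvPolynomial ι (MvPolynomial ι ℚ), ∀ c : ℚ,
      x * torusCoord i - C (C (1 / 2)) * (torusCoord i ^ 2 + C (C c)) ∈ torusIdeal ι → T x := by
    intro i x c h
    refine ⟨1, C (1 / 2) * (X i ^ 2 + C c) * ∏ j ∈ Finset.univ.erase i, X j, ?_⟩
    convert (torusIdeal ι).mul_mem_left (∏ j ∈ Finset.univ.erase i, torusCoord j) h using 1
    rw [pow_one, ← Finset.mul_prod_erase _ _ (Finset.mem_univ i)]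
    simp only [map_add, map_mul, map_pow, map_prod, aeval_X, algHom_C,
      MvPolynomial.algebraMap_eq, IsScalarTower.algebraMap_apply ℚ (MvPolynomial ι ℚ)
        (MvPolynomial ι (MvPolynomial ι ℚ))]
    ring
  have hhalf : (C (C (1 / 2 : ℚ)) * 2 : MvPolynomial ι (MvPolynomial ι ℚ)) = 1 := by
    rw [← map_ofNat (C : MvPolynomial ι ℚ →+* _) 2, ← map_ofNat (C : ℚ →+* _) 2, ← map_mul,
      ← map_mul]
    norm_num
  have hm : ∀ i, (X i ^ 2 - C (X i ^ 2 - 4) : MvPolynomial ι (MvPolynomial ι ℚ)) ∈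
    torusIdeal ι := fun i => Ideal.subset_span ⟨i, rfl⟩
  have hX : ∀ i, T (X i) := fun i => by
    refine hgen i _ (-4) ?_
    convert (torusIdeal ι).mul_mem_left (C (C (1 / 2 : ℚ))) (hm i) using 1
    simp only [torusCoord, map_sub, map_pow, map_neg, map_ofNat]
    linear_combination (-(X i * (C (X i) + X i))) * hhalf
  have hCX : ∀ i, T (C (X i)) := fun i => by
    refine hgen i _ 4 ?_
    convert (torusIdeal ι).mul_mem_left (-C (C (1 / 2 : ℚ))) (hm i) using 1
    simp only [torusCoord, map_sub, map_pow, map_ofNat]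
    linear_combination (-(C (X i) * (C (X i) + X i))) * hhalf
  have hC : ∀ r : MvPolynomial ι ℚ, T (C r) := fun r => by
    induction r using MvPolynomial.induction_on with
    | C r => exact hconst r
    | add p q hp hq => rw [map_add]; exact hadd _ _ hp hq
    | mul_X p i hp => rw [map_mul]; exact hmul _ _ hp (hCX i)
  change T q
  induction q using MvPolynomial.induction_on with
  | C r => exact hC r
  | add p q hp hq => exact hadd _ _ hp hq
  | mul_X p i hp => exact hmul _ _ hp (hX i)

theorem mem_torusIdeal [Fintype ι] {q : MvPolynomial ι (MvPolynomial ι ℚ)}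
    (hq : ∀ a, torusEval a q = 0) : q ∈ torusIdeal ι := by
  obtain ⟨N, G, h⟩ := exists_mul_pow_sub_mem q
  have hcoord : ∀ (a : ι → ℂˣ) i, torusEval a (torusCoord i) = 2 * a i := fun a i => by
    simp only [torusEval, torusCoord, map_add, coe_eval₂Hom, eval₂_X, eval₂_C,
      AlgHom.toRingHom_eq_coe, RingHom.coe_coe, aeval_X]
    ring
  have hG : ∀ b : ι → ℂ, (∀ i, b i ≠ 0) → aeval b G = 0 := fun b hb => by
    let a : ι → ℂˣ := fun i => Units.mk0 (b i / 2) (by simpa using hb i)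
    have h₁ := torusEval_eq_zero_of_mem a h
    rw [map_sub, map_mul, hq, zero_mul, zero_sub, neg_eq_zero, aeval_def, ← coe_eval₂Hom,
      ← RingHom.comp_apply] at h₁
    rw [← h₁, aeval_def, ← coe_eval₂Hom]
    congr 1
    refine MvPolynomial.ringHom_ext (fun r => ?_) fun i => ?_
    · simp
    · simp [hcoord, a, mul_div_cancel₀]
  have hG0 : G = 0 := by
    have h₁ : map (algebraMap ℚ ℂ) G * ∏ i, X i = 0 := by
      refine MvPolynomial.funext fun b => ?_
      rw [map_mul, map_prod, map_zero, eval_map]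
      by_cases hb : ∀ i, b i ≠ 0
      · rw [← aeval_def, hG b hb, zero_mul]
      · push Not at hb
        obtain ⟨i, hi⟩ := hb
        rw [Finset.prod_eq_zero (Finset.mem_univ i) (by simpa using hi), mul_zero]
    have h₂ : map (algebraMap ℚ ℂ) G = 0 :=
      (mul_eq_zero.1 h₁).resolve_right (Finset.prod_ne_zero_iff.2 fun i _ => X_ne_zero i)
    exact (map_injective _ (algebraMap ℚ ℂ).injective) (by rw [h₂, map_zero])
  rw [hG0, map_zero, sub_zero, ← Ideal.Quotient.eq_zero_iff_mem, map_mul, map_pow, map_prod] at h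
  have hu : IsUnit ((∏ i, Ideal.Quotient.mk (torusIdeal ι) (torusCoord i)) ^ N) :=
    IsUnit.pow _ (IsUnit.prod_univ_iff.2 isUnit_mk_torusCoord)
  exact Ideal.Quotient.eq_zero_iff_mem.1 (hu.mul_left_eq_zero.1 h)

end Torus

section Generators

variable {n : ℕ}

theorem tpp_self (i : Fin n) : tpp n i i = tp n i ^ 2 + 4 * tp n i := by simp [tpp]

theorem tpp_of_lt {i j : Fin n} (h : i < j) :
    tpp n i j = MvPolynomial.X (Sum.inr ⟨(i, j), h⟩) - 2 := by simp [tpp, h]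

theorem tpp_comm (i j : Fin n) : tpp n i j = tpp n j i := by
  rcases lt_trichotomy i j with h | rfl | h
  · simp [tpp, h, h.not_gt]
  · rfl
  · simp [tpp, h, h.not_gt]

/-- The polynomial `2 t_{ij} - t_i t_j`, which represents twice the trace form of the traceless
parts of the images of `x_i` and `x_j`. -/
def tracelessForm (i j : Fin n) : P n :=
  2 * (tpp n i j + 2) - (tp n i + 2) * (tp n j + 2)

theorem four_mul_gGen (i j r s : Fin n) :
    4 * gGen n i j r s = tracelessForm i r * tracelessForm j s -
      tracelessForm i s * tracelessForm j r := by
  have h : (MvPolynomial.C (1 / 2 : ℚ) * 2 : P n) = 1 := by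
    rw [← map_ofNat (MvPolynomial.C : ℚ →+* P n) 2, ← map_mul]
    norm_num
  unfold gGen tracelessForm
  linear_combination (2 * (tp n j * tp n r * tpp n i s + tp n i * tp n s * tpp n j r
          - tp n i * tp n r * tpp n j s - tp n j * tp n s * tpp n i r)) * h

theorem piBar_tp (i : Fin n) (ρ : H n →* SL2) :
    piBar n (tp n i) ρ = trc (xgen n i) ρ - 2 := by
  simp [tp, piBar]

theorem piBar_tpp (i j : Fin n) (ρ : H n →* SL2) :
    piBar n (tpp n i j) ρ = trc (xgen n i * xgen n j) ρ - 2 := by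
  wlog h : i ≤ j generalizing i j
  · rw [tpp_comm, mul_comm, this j i (le_of_not_ge h)]
  rcases h.eq_or_lt with rfl | h
  · have hdet := (ρ (xgen n i)).det_coe
    rw [Matrix.det_fin_two] at hdet
    rw [tpp_self, map_add, map_pow, map_mul, map_ofNat]
    simp only [Pi.add_apply, Pi.mul_apply, Pi.pow_apply, Pi.ofNat_apply, piBar_tp, trc, map_mul,
      Matrix.SpecialLinearGroup.coe_mul, Matrix.trace_fin_two, Matrix.mul_apply, Fin.sum_univ_two]
    linear_combination 2 * hdet
  · simp [tpp_of_lt h, piBar]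

theorem gGen_mem_Iideal (i j r s : Fin n) : gGen n i j r s ∈ Iideal n := by
  have key : piBar n (4 * gGen n i j r s) = 0 := by
    funext ρ
    have hcomm : ∀ k l, (ρ (xgen n k) : Matrix (Fin 2) (Fin 2) ℂ) * ρ (xgen n l) =
        ρ (xgen n l) * ρ (xgen n k) := fun k l => by
      rw [← Matrix.SpecialLinearGroup.coe_mul, ← Matrix.SpecialLinearGroup.coe_mul, ← map_mul,
        ← map_mul, mul_comm]
    have hij := hcomm i j
    have h00 := congrFun (congrFun hij 0) 0
    have h01 := congrFun (congrFun hij 0) 1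
    have h10 := congrFun (congrFun hij 1) 0
    rw [four_mul_gGen]
    simp only [tracelessForm, map_sub, map_add, map_mul, map_ofNat, Pi.add_apply, Pi.mul_apply,
      Pi.sub_apply, Pi.ofNat_apply, piBar_tp, piBar_tpp, trc,
      Matrix.SpecialLinearGroup.coe_mul, Matrix.trace_fin_two, Matrix.mul_apply,
      Fin.sum_univ_two] at h00 h01 h10 ⊢
    generalize (ρ (xgen n i) : Matrix (Fin 2) (Fin 2) ℂ) = A at *
    generalize (ρ (xgen n j) : Matrix (Fin 2) (Fin 2) ℂ) = B at *
    generalize (ρ (xgen n r) : Matrix (Fin 2) (Fin 2) ℂ) = U at *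
    generalize (ρ (xgen n s) : Matrix (Fin 2) (Fin 2) ℂ) = V at *
    linear_combination 4 * (U 1 0 * V 0 1 - U 0 1 * V 1 0) * h00
      + 2 * ((U 0 0 - U 1 1) * V 1 0 - U 1 0 * (V 0 0 - V 1 1)) * h01
      - 2 * ((U 0 0 - U 1 1) * V 0 1 - U 0 1 * (V 0 0 - V 1 1)) * h10
  have h : (4 : FR n) * piBar n (gGen n i j r s) = 0 := by rwa [map_mul, map_ofNat] at key
  change piBar n (gGen n i j r s) = 0
  funext ρ
  have := congrFun h ρ
  simpa using this

/-- The diagonal representation of `H` with eigenvalues `a_i` and `a_i⁻¹`. -/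
def diagRep (a : Fin n → ℂˣ) : H n →* SL2 where
  toFun x := ⟨!![((∏ i, a i ^ (x.toAdd i) : ℂˣ) : ℂ), 0;
    0, ((∏ i, a i ^ (x.toAdd i) : ℂˣ)⁻¹ : ℂˣ)], by
      rw [Matrix.det_fin_two_of, Units.mul_inv, mul_zero, sub_zero]⟩
  map_one' := by
    ext i j
    fin_cases i <;> fin_cases j <;> simp
  map_mul' x y := by
    have h : ∏ i, a i ^ ((x * y).toAdd i) = (∏ i, a i ^ (x.toAdd i)) * ∏ i, a i ^ (y.toAdd i) := by
      rw [← Finset.prod_mul_distrib]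
      exact Finset.prod_congr rfl fun i _ => zpow_add _ _ _
    refine Subtype.ext ?_
    change _ = !![((∏ i, a i ^ (x.toAdd i) : ℂˣ) : ℂ), 0; 0, ((∏ i, a i ^ (x.toAdd i) : ℂˣ)⁻¹ : ℂˣ)]
      * !![((∏ i, a i ^ (y.toAdd i) : ℂˣ) : ℂ), 0; 0, ((∏ i, a i ^ (y.toAdd i) : ℂˣ)⁻¹ : ℂˣ)]
    simp only [h, mul_inv, Units.val_mul, Matrix.mul_fin_two, mul_zero, zero_mul, add_zero,
      zero_add]

theorem diagRep_xgen (a : Fin n → ℂˣ) (i : Fin n) :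
    (diagRep a (xgen n i) : Matrix (Fin 2) (Fin 2) ℂ) = !![(a i : ℂ), 0; 0, ((a i)⁻¹ : ℂˣ)] := by
  have h : ∏ k, a k ^ ((xgen n i).toAdd k) = a i := by
    rw [Finset.prod_eq_single i]
    · simp [xgen]
    · intro k _ hk
      simp [xgen, hk]
    · simp
  change !![((∏ k, a k ^ ((xgen n i).toAdd k) : ℂˣ) : ℂ), 0;
    0, ((∏ k, a k ^ ((xgen n i).toAdd k) : ℂˣ)⁻¹ : ℂˣ)] = _
  rw [h]

open MvPolynomial in
/-- The lift of `piBar` to polynomial functions on the diagonal torus, given by `t_i ↦ τ_i` and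
`2 t_{ij} ↦ τ_i τ_j + δ_i δ_j`. -/
def torusLift (n : ℕ) : P n →ₐ[ℚ] MvPolynomial (Fin n) (MvPolynomial (Fin n) ℚ) :=
  aeval fun v =>
    match v with
    | Sum.inl i => C (X i)
    | Sum.inr p => C (C (1 / 2)) * (C (X p.1.1 * X p.1.2) + X p.1.1 * X p.1.2)

theorem torusEval_torusLift (a : Fin n → ℂˣ) (p : P n) :
    torusEval a (torusLift n p) = piBar n p (diagRep a) := by
  have h : (torusEval a).comp (torusLift n).toRingHom =
      (Pi.evalRingHom _ (diagRep a)).comp (piBar n).toRingHom := by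
    refine MvPolynomial.ringHom_ext (fun r => ?_) ?_
    · simp [torusEval, torusLift, MvPolynomial.algebraMap_eq, IsScalarTower.algebraMap_apply ℚ
        (MvPolynomial (Fin n) ℚ) (MvPolynomial (Fin n) (MvPolynomial (Fin n) ℚ))]
    · rintro (i | ⟨⟨i, j⟩, hij⟩)
      · simp [torusEval, torusLift, piBar, trc, diagRep_xgen, Matrix.trace_fin_two]
      · simp [torusEval, torusLift, piBar, trc, diagRep_xgen, Matrix.trace_fin_two]
        ring
  exact congrArg (fun f => f p) h

open MvPolynomial in
theorem Iideal_le_of_gGen_mem (J : Ideal (P n)) (hJ : ∀ i j r s, gGen n i j r s ∈ J) :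
    Iideal n ≤ J := by
  intro p hp
  have hmem : torusLift n p ∈ torusIdeal (Fin n) := mem_torusIdeal fun a => by
    rw [torusEval_torusLift]
    exact congrFun (show piBar n p = 0 from hp) _
  let φ : MvPolynomial (Fin n) ℚ →+* P n ⧸ J :=
    (Ideal.Quotient.mk J).comp (rename Sum.inl).toRingHom
  let _ : Algebra (MvPolynomial (Fin n) ℚ) (P n ⧸ J) := φ.toAlgebra
  have hφC : ∀ r : ℚ, φ (C r) = Ideal.Quotient.mk J (C r) := fun r => by simp [φ]
  have hφX : ∀ i, φ (X i) = Ideal.Quotient.mk J (X (Sum.inl i)) := fun i => by simp [φ]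
  have hswap : ∀ i j k l : Fin n,
      Ideal.Quotient.mk J (tracelessForm i j) * Ideal.Quotient.mk J (tracelessForm k l) =
        Ideal.Quotient.mk J (tracelessForm i k) * Ideal.Quotient.mk J (tracelessForm j l) := by
    intro i j k l
    rw [← map_mul, ← map_mul, Ideal.Quotient.eq]
    convert J.mul_mem_left 4 (hJ i l j k) using 1
    rw [four_mul_gGen]
    simp only [tracelessForm, tpp_comm l j, tpp_comm l k]
    ring
  obtain ⟨Ψ, h1, hΨ⟩ := exists_linear_of_pairing (R := MvPolynomial (Fin n) ℚ)
    (fun i j => Ideal.Quotient.mk J (tracelessForm i j))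
    (fun i j => by simp only [tracelessForm, tpp_comm i j, mul_comm (tp n i + 2)]) hswap
  have hΨC : ∀ r q, Ψ (C r * q) = φ r * Ψ q := fun r q => by
    rw [← smul_eq_C_mul, map_smul]
    rfl
  have hlift : ∀ p q, Ψ (torusLift n p * q) = Ideal.Quotient.mk J p * Ψ q := by
    intro p
    induction p using MvPolynomial.induction_on with
    | C r =>
      intro q
      rw [← hφC, ← hΨC]
      congr 2
      simp [torusLift, MvPolynomial.algebraMap_eq, IsScalarTower.algebraMap_apply ℚ
        (MvPolynomial (Fin n) ℚ) (MvPolynomial (Fin n) (MvPolynomial (Fin n) ℚ))]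
    | add p₁ p₂ h₁ h₂ => intro q; rw [map_add, add_mul, map_add, h₁, h₂, map_add, add_mul]
    | mul_X p v h =>
      intro q
      rw [map_mul (torusLift n), mul_assoc, h, map_mul (Ideal.Quotient.mk J), mul_assoc]
      congr 1
      rcases v with i | ⟨⟨i, j⟩, hij⟩
      · rw [← hφX, ← hΨC]
        simp [torusLift]
      · have hv : torusLift n (X (Sum.inr ⟨(i, j), hij⟩)) =
            C (C (1 / 2)) * (C (X i * X j) + X i * X j) := by simp [torusLift]
        rw [hv, mul_assoc, hΨC, add_mul, map_add, hΨC, hΨ, ← add_mul, ← mul_assoc, map_mul, hφC,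
          hφX, hφX, ← map_mul, ← map_add, ← map_mul]
        congr 2
        have h : (C (1 / 2 : ℚ) * 2 : P n) = 1 := by
          rw [← map_ofNat (C : ℚ →+* P n) 2, ← map_mul]
          norm_num
        rw [tracelessForm, tpp_of_lt hij, tp, tp]
        linear_combination X (Sum.inr ⟨(i, j), hij⟩) * h
  have hvanish : ∀ q ∈ torusIdeal (Fin n), ∀ x, Ψ (q * x) = 0 := by
    have hgen : ∀ i x, Ψ ((X i ^ 2 - C (X i ^ 2 - 4)) * x) = 0 := fun i x => by
      rw [sub_mul, map_sub, pow_two, hΨ, hΨC, ← sub_mul, map_sub, map_pow, map_ofNat, hφX,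
        tracelessForm, tpp_self, tp]
      simp only [map_sub, map_add, map_mul, map_pow, map_ofNat]
      ring
    intro q hq
    induction hq using Submodule.span_induction with
    | mem x hx =>
      obtain ⟨i, rfl⟩ := hx
      exact hgen i
    | zero => intro y; rw [zero_mul, map_zero]
    | add x y _ _ hx hy => intro z; rw [add_mul, map_add, hx, hy, add_zero]
    | smul c x _ hx => intro y; rw [smul_eq_mul, mul_comm c, mul_assoc, hx]
  have := hlift p 1
  rw [hvanish _ hmem, h1, mul_one] at this
  exact Ideal.Quotient.eq_zero_iff_mem.1 this.symm

end Generators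

/-- **Theorem (Theorem 3.3 / Theorem 1.3)**: the ideal `I = ker π̄` is generated by the elements
`g_{i,j,r,s}` for `1 ≤ i, j, r, s ≤ n`; in particular, `I` is finitely generated. -/
theorem Iideal_eq_span_gGen (n : ℕ) (hn : 1 ≤ n) :
    Iideal n = Ideal.span (Set.range fun x : Fin n × Fin n × Fin n × Fin n =>
        gGen n x.1 x.2.1 x.2.2.1 x.2.2.2) ∧ (Iideal n).FG := by
  have h : Iideal n = Ideal.span (Set.range fun x : Fin n × Fin n × Fin n × Fin n =>
      gGen n x.1 x.2.1 x.2.2.1 x.2.2.2) := by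
    refine le_antisymm (Iideal_le_of_gGen_mem _ fun i j r s =>
      Ideal.subset_span ⟨(i, j, r, s), rfl⟩) (Ideal.span_le.2 ?_)
    rintro _ ⟨x, rfl⟩
    exact gGen_mem_Iideal _ _ _ _
  refine ⟨h, ?_⟩
  rw [h]
  exact Submodule.fg_span (Set.finite_range _)
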